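/- Let A, B ∈ ℂ[t] with A ≠ 0 and deg(A) = n. If n is even, or if B ≠ 0 and 2·deg(B) > n − 1, then the set {p ∈ ℂ[t] : p ≠ 0 and p·p' − p·B + A = 0} of invariant polynomials has at most two elements; that is, the Abel equation x' = A(t)x³ + B(t)x² has at most two invariant curves 1 + p(t)x = 0. -/

import Mathlib

open Polynomial

/-- The degrees of two distinct invariant polynomials add up to `deg A + 1`. -/
theorem natDegree_add_natDegree_of_invariant {A B p q : ℂ[X]} (hA : A ≠ 0)
    (hp₀ : p ≠ 0) (hp : p * derivative p - p * B + A = 0)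
    (hq₀ : q ≠ 0) (hq : q * derivative q - q * B + A = 0) (hpq : p ≠ q) :
    p.natDegree + q.natDegree = A.natDegree + 1 := by
  have hsub : p - q ≠ 0 := sub_ne_zero.mpr hpq
  have key : p * q * derivative (p - q) = A * (p - q) := by
    rw [derivative_sub]
    linear_combination q * hp - p * hq
  have hd : derivative (p - q) ≠ 0 := by
    intro h
    rw [h, mul_zero] at key
    exact mul_ne_zero hA hsub key.symm
  have hpos : (p - q).natDegree ≠ 0 := fun h ↦
    hd (derivative_of_natDegree_zero h)
  have hdeg := congrArg natDegree key
  rw [natDegree_mul (mul_ne_zero hp₀ hq₀) hd, natDegree_mul hp₀ hq₀, natDegree_mul hA hsub,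
    natDegree_derivative] at hdeg
  lia

/-- An invariant polynomial of degree `(deg A + 1) / 2` forces `2 deg B ≤ deg A - 1`. -/
theorem two_mul_natDegree_lt_of_invariant {A B p : ℂ[X]} (hA : A ≠ 0)
    (hp : p * derivative p - p * B + A = 0) (hdeg : 2 * p.natDegree = A.natDegree + 1) :
    2 * B.natDegree < A.natDegree := by
  have hfac : A = p * (B - derivative p) := by linear_combination hp
  have hne := hfac ▸ hA
  have hA_deg := congrArg natDegree hfac
  rw [natDegree_mul (left_ne_zero_of_mul hne) (right_ne_zero_of_mul hne)] at hA_deg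
  have hB := natDegree_add_le (B - derivative p) (derivative p)
  rw [sub_add_cancel, natDegree_derivative] at hB
  lia

/-- Theorem A, first part: if `n = deg A` is even, or if `B ≠ 0` and
`2 deg B > n - 1`, then the Abel equation `x' = A x³ + B x²` has at most two invariant
polynomials (invariant curves `1 + p(t)x = 0`). -/
theorem abel_at_most_two_invariants (A B : ℂ[X]) (hA : A ≠ 0) (n : ℕ)
    (hn : A.natDegree = n)
    (h : Even n ∨ (B ≠ 0 ∧ 2 * B.natDegree > n - 1)) :
    ∃ p₁ p₂ : ℂ[X],
      {p : ℂ[X] | p ≠ 0 ∧ p * derivative p - p * B + A = 0} ⊆ {p₁, p₂} := by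
  by_contra hcon
  have hnew (p₁ p₂ : ℂ[X]) : ∃ p : ℂ[X],
      (p ≠ 0 ∧ p * derivative p - p * B + A = 0) ∧ p ≠ p₁ ∧ p ≠ p₂ := by
    obtain ⟨p, hp, hp'⟩ := Set.not_subset.mp fun hs ↦ hcon ⟨p₁, p₂, hs⟩
    exact ⟨p, hp, fun e ↦ hp' (Or.inl e), fun e ↦ hp' (Or.inr e)⟩
  obtain ⟨p, ⟨hp₀, hp⟩, -⟩ := hnew 0 0
  obtain ⟨q, ⟨hq₀, hq⟩, hqp, -⟩ := hnew p p
  obtain ⟨r, ⟨hr₀, hr⟩, hrp, hrq⟩ := hnew p q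
  have hqp_deg := natDegree_add_natDegree_of_invariant hA hq₀ hq hp₀ hp hqp
  have hrp_deg := natDegree_add_natDegree_of_invariant hA hr₀ hr hp₀ hp hrp
  have hrq_deg := natDegree_add_natDegree_of_invariant hA hr₀ hr hq₀ hq hrq
  have hB := two_mul_natDegree_lt_of_invariant hA hp (by lia)
  rcases h with ⟨k, hk⟩ | ⟨-, h⟩ <;> lia
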